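/- arXiv:2403.06626 — 2 statements merged into one kernel-verified Lean document; each statement's English description precedes it below -/
import Mathlib

section
/- Let ζ := (1/4)·Σ_{0 ≠ n ∈ ℤ[i]} N(n)^{−2} (the value at 2 of the Dedekind zeta function of ℚ(i)). For every ε > 0 there exists C > 0 such that for all real S ≥ 1 and all nonzero q ∈ ℤ[i], |#{s ∈ ℤ[i] : 0 < N(s) ≤ S, s squarefree, gcd(s, q) a unit} − (π·S/ζ)·∏_{p ∣ q} (1 + N(p)^{−1})^{−1}| ≤ C·τ(q)·S^{1/2+ε}, where the product runs over the distinct prime divisors p of q taken up to associates. -/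
noncomputable section

namespace PGT

def Gnorm (n : GaussianInt) : ℕ := (Zsqrtd.norm n).natAbs

def Gphi (c : GaussianInt) : ℕ :=
  Nat.card (GaussianInt ⧸ Ideal.span ({c} : Set GaussianInt))ˣ

def rhoc (c δ : GaussianInt) : ℕ :=
  Nat.card {x : GaussianInt ⧸ Ideal.span ({2 * c} : Set GaussianInt) //
    ∃ y : GaussianInt, Ideal.Quotient.mk (Ideal.span ({2 * c} : Set GaussianInt)) y = x ∧
      4 * c ∣ y ^ 2 - δ}

def rhoG (c a : GaussianInt) : ℕ :=
  Nat.card {d : GaussianInt ⧸ Ideal.span ({c} : Set GaussianInt) //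
    d ^ 2 - (Ideal.Quotient.mk (Ideal.span ({c} : Set GaussianInt)) a) * d + 1 = 0}

def NStar (c : GaussianInt) : ℕ :=
  sSup {m : ℕ | ∃ d : GaussianInt, d ^ 2 ∣ c ∧ m = Gnorm d}

open Classical in
def muG (c : GaussianInt) : ℤ :=
  if Squarefree c then (-1) ^ (UniqueFactorizationMonoid.factors c).card else 0

def genG (I : Ideal GaussianInt) : GaussianInt := Submodule.IsPrincipal.generator I

def lamc (c δ : GaussianInt) : ℤ :=
  ∑ᶠ t ∈ {t : Ideal GaussianInt × Ideal GaussianInt × Ideal GaussianInt |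
      t.1 ^ 2 * t.2.1 * t.2.2 = Ideal.span ({c} : Set GaussianInt)},
    muG (genG t.2.1) * (rhoc (genG t.2.2) δ : ℤ)

open Classical in
def legG (p x : GaussianInt) : ℤ :=
  if p ∣ x then 0 else if ∃ y : GaussianInt, p ∣ y ^ 2 - x then 1 else -1

def quadSym (r x : GaussianInt) : ℤ :=
  ((UniqueFactorizationMonoid.factors r).map (fun p => legG p x)).prod

def muTilde (r : GaussianInt) : ℤ :=
  ∑ᶠ a : GaussianInt ⧸ Ideal.span ({r} : Set GaussianInt),
    quadSym r ((Quotient.out a) ^ 2 - 4)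

def tauI (n : GaussianInt) : ℕ :=
  Nat.card {I : Ideal GaussianInt // I ∣ Ideal.span ({n} : Set GaussianInt)}

def zetaQi : ℝ := (1 / 4) * ∑' n : {n : GaussianInt // n ≠ 0}, 1 / ((Gnorm n.1 : ℝ)) ^ 2

def eG (t : ℝ) : ℂ := Complex.exp (2 * Real.pi * Complex.I * t)

def kloost (m n c : GaussianInt) : ℂ :=
  ∑ᶠ a : (GaussianInt ⧸ Ideal.span ({c} : Set GaussianInt))ˣ,
    eG ((GaussianInt.toComplex
        (m * Quotient.out ((a : GaussianInt ⧸ Ideal.span ({c} : Set GaussianInt))) +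
         n * Quotient.out (((a⁻¹ : (GaussianInt ⧸ Ideal.span ({c} : Set GaussianInt))ˣ) :
            GaussianInt ⧸ Ideal.span ({c} : Set GaussianInt)))) /
      GaussianInt.toComplex c).re)


open Filter Topology MeasureTheory

lemma Gnorm_mul (a b : GaussianInt) : Gnorm (a * b) = Gnorm a * Gnorm b := by
  simp [Gnorm, Zsqrtd.norm_mul, Int.natAbs_mul]

lemma Gnorm_pos {a : GaussianInt} : 0 < Gnorm a ↔ a ≠ 0 := by
  rw [Gnorm, Int.natAbs_pos, Ne, GaussianInt.norm_eq_zero]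

lemma Gnorm_cast (a : GaussianInt) : (Gnorm a : ℝ) = (a.re : ℝ) ^ 2 + (a.im : ℝ) ^ 2 := by
  rw [Gnorm, GaussianInt.natAbs_norm_eq]
  push_cast [Nat.cast_natAbs, Int.cast_abs]
  rw [abs_mul_abs_self, abs_mul_abs_self, sq, sq]

lemma Gnorm_cast_eq_norm_sq (a : GaussianInt) :
    (Gnorm a : ℝ) = ‖GaussianInt.toComplex a‖ ^ 2 := by
  rw [Gnorm_cast, Complex.sq_norm, Complex.normSq_apply, ← GaussianInt.intCast_re,
    ← GaussianInt.intCast_im, sq, sq]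

lemma Gnorm_prod {ι : Type*} (w : ι → GaussianInt) (T : Finset ι) :
    Gnorm (∏ i ∈ T, w i) = ∏ i ∈ T, Gnorm (w i) := by
  classical
  induction T using Finset.induction_on with
  | empty => simp [Gnorm]
  | insert a s h ih => rw [Finset.prod_insert h, Finset.prod_insert h, Gnorm_mul, ih]

lemma finite_Gnorm_le (X : ℝ) : {n : GaussianInt | (Gnorm n : ℝ) ≤ X}.Finite := by
  have h : ((fun p : ℤ × ℤ ↦ (⟨p.1, p.2⟩ : GaussianInt)) ''
      (Set.Icc (-⌈X⌉) ⌈X⌉ ×ˢ Set.Icc (-⌈X⌉) ⌈X⌉)).Finite :=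
    ((Set.finite_Icc _ _).prod (Set.finite_Icc _ _)).image _
  refine h.subset fun n hn ↦ ⟨(n.re, n.im), ?_, rfl⟩
  have hX : n.re ^ 2 + n.im ^ 2 ≤ ⌈X⌉ := by
    have : ((n.re ^ 2 + n.im ^ 2 : ℤ) : ℝ) ≤ (⌈X⌉ : ℝ) := by
      push_cast
      rw [← Gnorm_cast]
      exact le_trans hn (Int.le_ceil X)
    exact_mod_cast this
  have h1 := Int.natAbs_le_self_sq n.re
  have h2 := Int.natAbs_le_self_sq n.im
  have h3 := sq_nonneg n.re
  have h4 := sq_nonneg n.im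
  simp only [Set.mem_prod, Set.mem_Icc]
  omega

/-- The half-open unit square of `ℂ` with lower left corner `n`. -/
def cell (n : GaussianInt) : Set ℂ := {z | ⌊z.re⌋ = n.re ∧ ⌊z.im⌋ = n.im}

lemma measurableSet_cell (n : GaussianInt) : MeasurableSet (cell n) :=
  ((Int.measurable_floor.comp Complex.measurable_re) (measurableSet_singleton n.re)).inter
    ((Int.measurable_floor.comp Complex.measurable_im) (measurableSet_singleton n.im))

lemma volume_cell (n : GaussianInt) : volume (cell n) = 1 := by
  have h : cell n = Complex.measurableEquivRealProd ⁻¹'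
      (Set.Ico (n.re : ℝ) (n.re + 1) ×ˢ Set.Ico (n.im : ℝ) (n.im + 1)) := by
    ext z
    simp [cell, Int.floor_eq_iff]
  rw [h, Complex.volume_preserving_equiv_real_prod.measure_preimage
    (measurableSet_Ico.prod measurableSet_Ico).nullMeasurableSet, Measure.volume_eq_prod,
    Measure.prod_prod]
  simp

lemma volume_biUnion_cell (s : Finset GaussianInt) :
    volume (⋃ n ∈ s, cell n) = s.card := by
  rw [measure_biUnion_finset _ fun n _ ↦ measurableSet_cell n]
  · simp [volume_cell]
  · intro a _ b _ hab
    refine Set.disjoint_left.2 fun z hz hz' ↦ hab ?_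
    exact Zsqrtd.ext (hz.1.symm.trans hz'.1) (hz.2.symm.trans hz'.2)

lemma norm_sub_le_of_mem_cell {n : GaussianInt} {z : ℂ} (hz : z ∈ cell n) :
    ‖z - GaussianInt.toComplex n‖ ≤ 2 := by
  refine (Complex.norm_le_abs_re_add_abs_im _).trans ?_
  obtain ⟨h1, h2⟩ := hz
  rw [Int.floor_eq_iff] at h1 h2
  have e1 : |(z - GaussianInt.toComplex n).re| ≤ 1 := by
    rw [Complex.sub_re, ← GaussianInt.intCast_re, abs_le]; constructor <;> linarith
  have e2 : |(z - GaussianInt.toComplex n).im| ≤ 1 := by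
    rw [Complex.sub_im, ← GaussianInt.intCast_im, abs_le]; constructor <;> linarith
  linarith

open Classical in
/-- The nonzero Gaussian integers of norm at most `X`. -/
def normBall (X : ℝ) : Finset GaussianInt := (finite_Gnorm_le X).toFinset.erase 0

lemma mem_normBall {X : ℝ} {n : GaussianInt} : n ∈ normBall X ↔ n ≠ 0 ∧ (Gnorm n : ℝ) ≤ X := by
  simp [normBall]

lemma card_Gnorm_le {X : ℝ} (hX : 0 ≤ X) :
    (finite_Gnorm_le X).toFinset.card = (normBall X).card + 1 := by
  classical
  rw [normBall, Finset.card_erase_add_one]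
  simpa [Gnorm] using hX

lemma abs_card_sub_le {X : ℝ} (hX : 1 ≤ X) :
    |((finite_Gnorm_le X).toFinset.card : ℝ) - Real.pi * X| ≤ 8 * Real.pi * √X := by
  set s := (finite_Gnorm_le X).toFinset with hs
  have hr : 1 ≤ √X := by rwa [Real.one_le_sqrt]
  have hrX : √X ^ 2 = X := Real.sq_sqrt (by linarith)
  have hmem : ∀ n, n ∈ s ↔ ‖GaussianInt.toComplex n‖ ≤ √X := fun n ↦ by
    rw [hs, Set.Finite.mem_toFinset, Set.mem_ofPred_eq, Gnorm_cast_eq_norm_sq,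
      Real.le_sqrt (norm_nonneg _) (by linarith)]
  have up : (s.card : ENNReal) ≤ volume (Metric.closedBall (0 : ℂ) (√X + 2)) := by
    rw [← volume_biUnion_cell]
    refine measure_mono (Set.iUnion₂_subset fun n hn z hz ↦ ?_)
    rw [mem_closedBall_zero_iff]
    have := norm_sub_le_of_mem_cell hz
    have h2 := (hmem n).1 hn
    have h3 := norm_le_norm_add_norm_sub' z (GaussianInt.toComplex n)
    linarith
  have low : volume (Metric.closedBall (0 : ℂ) (√X - 2)) ≤ (s.card : ENNReal) := by
    rw [← volume_biUnion_cell]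
    refine measure_mono fun z hz ↦ ?_
    rw [mem_closedBall_zero_iff] at hz
    have hc : z ∈ cell ⟨⌊z.re⌋, ⌊z.im⌋⟩ := ⟨rfl, rfl⟩
    refine Set.mem_iUnion₂.2 ⟨_, (hmem _).2 ?_, hc⟩
    have := norm_sub_le_of_mem_cell hc
    have h3 := norm_le_norm_add_norm_sub z (GaussianInt.toComplex ⟨⌊z.re⌋, ⌊z.im⌋⟩)
    linarith
  rw [Complex.volume_closedBall] at up low
  have up' := ENNReal.toReal_mono (by finiteness) up
  have low' := ENNReal.toReal_mono (by finiteness) low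
  have hpi := Real.pi_pos
  simp only [ENNReal.toReal_mul, ENNReal.toReal_pow, ENNReal.toReal_natCast,
    ENNReal.coe_toReal, NNReal.coe_real_pi] at up' low'
  rw [ENNReal.toReal_ofReal (by linarith)] at up'
  rw [abs_le]
  constructor
  · rcases le_total 2 (√X) with h | h
    · rw [ENNReal.toReal_ofReal (by linarith)] at low'
      nlinarith
    · have : (0 : ℝ) ≤ s.card := by positivity
      have h4 : √X * √X ≤ 2 * √X := by gcongr
      nlinarith [mul_le_mul_of_nonneg_left h4 hpi.le, mul_pos hpi (by linarith : 0 < √X)]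
  · nlinarith

lemma abs_card_normBall_sub_le {X θ : ℝ} (hX : 0 < X) (hθ : 1 / 2 ≤ θ) (hθ' : θ ≤ 1) :
    |((normBall X).card : ℝ) - Real.pi * X| ≤ (8 * Real.pi + 1) * X ^ θ := by
  have hpi := Real.pi_pos
  rcases lt_or_ge X 1 with h | h
  · have h0 : (normBall X).card = 0 := by
      refine Finset.card_eq_zero.2 (Finset.eq_empty_of_forall_notMem fun n hn ↦ ?_)
      obtain ⟨h1, h2⟩ := mem_normBall.1 hn
      have : (1 : ℝ) ≤ Gnorm n := by exact_mod_cast Gnorm_pos.2 h1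
      linarith
    have h1 : X ≤ X ^ θ := by
      simpa using Real.rpow_le_rpow_of_exponent_ge hX h.le hθ'
    rw [h0, Nat.cast_zero, zero_sub, abs_neg, abs_of_pos (by positivity)]
    nlinarith
  · have h1 : √X ≤ X ^ θ := by
      rw [Real.sqrt_eq_rpow]
      exact Real.rpow_le_rpow_of_exponent_le h hθ
    have h2 : 1 ≤ √X := by rwa [Real.one_le_sqrt]
    have h3 := abs_card_sub_le h
    rw [card_Gnorm_le (by linarith), abs_le] at h3
    push_cast at h3
    rw [abs_le]
    constructor <;> nlinarith

lemma summable_Gnorm_rpow {s : ℝ} (hs : 1 < s) :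
    Summable fun n : GaussianInt ↦ (Gnorm n : ℝ) ^ (-s) := by
  have h := EisensteinSeries.summable_one_div_norm_rpow (k := 2 * s) (by linarith)
  have hinj : Function.Injective fun n : GaussianInt ↦ (![n.re, n.im] : Fin 2 → ℤ) := by
    intro a b hab
    exact Zsqrtd.ext (congrFun hab 0) (congrFun hab 1)
  refine (h.comp_injective hinj).of_nonneg_of_le (fun n ↦ by positivity) fun n ↦ ?_
  rcases eq_or_ne n 0 with rfl | hn
  · simp [Gnorm, Real.zero_rpow (by linarith : -s ≠ 0)]
    positivity
  · have hv : (![n.re, n.im] : Fin 2 → ℤ) ≠ 0 := fun h0 ↦ hn (hinj (by simpa using h0))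
    have hpos : 0 < ‖(![n.re, n.im] : Fin 2 → ℤ)‖ := norm_pos_iff.2 hv
    have hle : ‖(![n.re, n.im] : Fin 2 → ℤ)‖ ^ 2 ≤ (Gnorm n : ℝ) := by
      rw [Gnorm_cast]
      rw [← Real.le_sqrt (by positivity) (by positivity), pi_norm_le_iff_of_nonneg (by positivity)]
      intro i
      apply Real.le_sqrt_of_sq_le
      fin_cases i <;> simp [Int.norm_eq_abs] <;> positivity
    have he : ‖(![n.re, n.im] : Fin 2 → ℤ)‖ ^ (-(2 * s)) =
        (‖(![n.re, n.im] : Fin 2 → ℤ)‖ ^ 2) ^ (-s) := by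
      rw [← Real.rpow_natCast, ← Real.rpow_mul hpos.le]
      congr 1
      push_cast
      ring
    rw [Function.comp_apply, he]
    exact Real.rpow_le_rpow_of_nonpos (by positivity) hle (by linarith)

section Sieve

variable {ι : Type*} {w : ι → GaussianInt}

lemma prod_dvd_iff (hw : Pairwise (Function.onFun IsRelPrime w)) (T : Finset ι) (s : GaussianInt) :
    ∏ i ∈ T, w i ∣ s ↔ ∀ i ∈ T, w i ∣ s :=
  ⟨fun h _ hi ↦ (Finset.dvd_prod_of_mem w hi).trans h,
    Finset.prod_dvd_of_isRelPrime (hw.set_pairwise _)⟩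

open Classical in
lemma hasSum_inclusion_exclusion (hw : Pairwise (Function.onFun IsRelPrime w)) {s : GaussianInt}
    (hfin : {i | w i ∣ s}.Finite) :
    HasSum (fun T : Finset ι ↦ if ∏ i ∈ T, w i ∣ s then (-1 : ℝ) ^ T.card else 0)
      (if ∀ i, ¬ w i ∣ s then 1 else 0) := by
  have hmem : ∀ T : Finset ι, T ∈ hfin.toFinset.powerset ↔ ∏ i ∈ T, w i ∣ s := fun T ↦ by
    rw [prod_dvd_iff hw, Finset.mem_powerset]
    exact ⟨fun h i hi ↦ by simpa using h hi, fun h i hi ↦ by simpa using h i hi⟩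
  have h := hasSum_sum_of_ne_finset_zero (L := .unconditional _) (s := hfin.toFinset.powerset)
    (f := fun T : Finset ι ↦ if ∏ i ∈ T, w i ∣ s then (-1 : ℝ) ^ T.card else 0)
    fun T hT ↦ if_neg fun h ↦ hT ((hmem T).2 h)
  convert h using 1
  rw [Finset.sum_congr rfl fun T hT ↦ if_pos ((hmem T).1 hT)]
  have h2 := Finset.sum_powerset_neg_one_pow_card (x := hfin.toFinset)
  have h3 : hfin.toFinset = ∅ ↔ ∀ i, ¬ w i ∣ s := by
    simp [Set.eq_empty_iff_forall_notMem]
  simp only [h3] at h2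
  exact_mod_cast h2.symm

lemma finite_dvd_of_summable {θ : ℝ} (hθ : 0 < θ) (hw0 : ∀ i, w i ≠ 0)
    (hs : Summable fun i ↦ (Gnorm (w i) : ℝ) ^ (-θ)) {s : GaussianInt} (h0 : s ≠ 0) :
    {i | w i ∣ s}.Finite := by
  have hpos : (0 : ℝ) < Gnorm s := by exact_mod_cast Gnorm_pos.2 h0
  have := hs.tendsto_cofinite_zero.eventually_lt_const (Real.rpow_pos_of_pos hpos (-θ))
  refine (Filter.eventually_cofinite.1 this).subset fun i ⟨m, hm⟩ ↦ ?_
  have hwi : (0 : ℝ) < Gnorm (w i) := by exact_mod_cast Gnorm_pos.2 (hw0 i)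
  refine not_lt.2 (Real.rpow_le_rpow_of_nonpos hwi ?_ (by linarith))
  have hm0 : m ≠ 0 := by rintro rfl; simp [hm] at h0
  rw [hm, Gnorm_mul]
  exact_mod_cast Nat.le_mul_of_pos_right _ (Gnorm_pos.2 hm0)

open Classical in
lemma card_filter_dvd_normBall {W : GaussianInt} (hW : W ≠ 0) (X : ℝ) :
    ((normBall X).filter (W ∣ ·)).card = (normBall (X / Gnorm W)).card := by
  have hpos : (0 : ℝ) < Gnorm W := by exact_mod_cast Gnorm_pos.2 hW
  symm
  refine Finset.card_bij (fun m _ ↦ W * m) (fun m hm ↦ ?_) (fun a _ b _ h ↦ mul_left_cancel₀ hW h)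
    fun s hs ↦ ?_
  · rw [mem_normBall, le_div_iff₀' hpos] at hm
    rw [Finset.mem_filter, mem_normBall, Gnorm_mul]
    exact ⟨⟨mul_ne_zero hW hm.1, by push_cast; exact hm.2⟩, dvd_mul_right _ _⟩
  · obtain ⟨hs, m, rfl⟩ := Finset.mem_filter.1 hs
    rw [mem_normBall, Gnorm_mul] at hs
    refine ⟨m, mem_normBall.2 ⟨right_ne_zero_of_mul hs.1, ?_⟩, rfl⟩
    rw [le_div_iff₀' hpos]
    exact_mod_cast hs.2

open Classical in
theorem abs_card_sieve_sub_le {θ : ℝ} (hθ : 1 / 2 ≤ θ) (hθ' : θ ≤ 1)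
    (hw : Pairwise (Function.onFun IsRelPrime w)) (hw0 : ∀ i, w i ≠ 0)
    (hs : Summable fun i ↦ (Gnorm (w i) : ℝ) ^ (-θ)) {X : ℝ} (hX : 0 < X) :
    |(((normBall X).filter fun s ↦ ∀ i, ¬ w i ∣ s).card : ℝ) -
        Real.pi * X * ∏' i, (1 + -(Gnorm (w i) : ℝ)⁻¹)| ≤
      (8 * Real.pi + 1) * X ^ θ * ∏' i, (1 + (Gnorm (w i) : ℝ) ^ (-θ)) := by
  have hN : ∀ i, (1 : ℝ) ≤ Gnorm (w i) := fun i ↦ by exact_mod_cast Gnorm_pos.2 (hw0 i)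
  have hs1 : Summable fun i ↦ ‖-(Gnorm (w i) : ℝ)⁻¹‖ := by
    refine hs.of_nonneg_of_le (fun i ↦ norm_nonneg _) fun i ↦ ?_
    rw [norm_neg, Real.norm_of_nonneg (by positivity), ← Real.rpow_neg_one]
    exact Real.rpow_le_rpow_of_exponent_le (hN i) (by linarith)
  have hsum := summable_finsetProd_of_summable_norm hs1
  have hsum' := summable_finsetProd_of_summable_nonneg (fun i ↦ by positivity) hs
  have hcount : HasSum
      (fun T : Finset ι ↦ (-1 : ℝ) ^ T.card * (normBall (X / Gnorm (∏ i ∈ T, w i))).card)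
      ((normBall X).filter fun s ↦ ∀ i, ¬ w i ∣ s).card := by
    have h := hasSum_sum (s := normBall X) fun s hs' ↦ hasSum_inclusion_exclusion hw
      (finite_dvd_of_summable (by linarith) hw0 hs (mem_normBall.1 hs').1)
    convert h using 1
    · funext T
      rw [← card_filter_dvd_normBall (Finset.prod_ne_zero_iff.2 fun i _ ↦ hw0 i),
        ← Finset.sum_filter, Finset.sum_const, nsmul_eq_mul, mul_comm]
    · simp
  have hmain := hsum.hasSum.mul_left (Real.pi * X)
  have herr := hsum'.hasSum.mul_left ((8 * Real.pi + 1) * X ^ θ)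
  rw [tprod_one_add hsum, tprod_one_add hsum', ← (hcount.sub hmain).tsum_eq, ← Real.norm_eq_abs]
  refine tsum_of_norm_bounded herr fun T ↦ ?_
  have hT : (0 : ℝ) < Gnorm (∏ i ∈ T, w i) := by
    exact_mod_cast Gnorm_pos.2 (Finset.prod_ne_zero_iff.2 fun i _ ↦ hw0 i)
  have h1 := abs_card_normBall_sub_le (div_pos hX hT) hθ hθ'
  rw [Finset.prod_neg, Finset.prod_inv_distrib, ← Nat.cast_prod, ← Gnorm_prod,
    Real.finsetProd_rpow _ _ fun i _ ↦ by positivity, ← Nat.cast_prod, ← Gnorm_prod]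
  have h2 : (-1 : ℝ) ^ T.card * ((normBall (X / Gnorm (∏ i ∈ T, w i))).card : ℝ) -
      Real.pi * X * ((-1) ^ T.card * (Gnorm (∏ i ∈ T, w i) : ℝ)⁻¹) =
      (-1) ^ T.card * (((normBall (X / Gnorm (∏ i ∈ T, w i))).card : ℝ) -
        Real.pi * (X / Gnorm (∏ i ∈ T, w i))) := by ring
  rw [h2, norm_mul, norm_pow, norm_neg, norm_one, one_pow, one_mul, Real.norm_eq_abs]
  refine h1.trans_eq ?_
  rw [Real.div_rpow hX.le hT.le, Real.rpow_neg hT.le]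
  ring

open Classical in
theorem tsum_mul_tprod_eq_tsum_coprime {f : GaussianInt → ℝ}
    (hf : Summable fun n ↦ ‖f n‖) (hf0 : f 0 = 0) (hmul : ∀ a b, f (a * b) = f a * f b)
    (hw : Pairwise (Function.onFun IsRelPrime w)) (hw0 : ∀ i, w i ≠ 0)
    (hfin : ∀ s ≠ 0, {i | w i ∣ s}.Finite) (hs : Summable fun i ↦ ‖f (w i)‖) (hf1 : f 1 = 1) :
    (∑' n, f n) * ∏' i, (1 + -f (w i)) = ∑' n, if ∀ i, ¬ w i ∣ n then f n else 0 := by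
  have hprod : ∀ T : Finset ι, f (∏ i ∈ T, w i) = ∏ i ∈ T, f (w i) := fun T ↦
    map_prod (⟨⟨f, hf1⟩, hmul⟩ : GaussianInt →* ℝ) w T
  have hW0 : ∀ T : Finset ι, ∏ i ∈ T, w i ≠ 0 := fun T ↦ Finset.prod_ne_zero_iff.2 fun i _ ↦ hw0 i
  have hmult : ∀ (W : GaussianInt), W ≠ 0 → ∀ (g : GaussianInt → ℝ), Summable g →
      (∀ a b, g (a * b) = g a * g b) →
      HasSum (fun n ↦ if W ∣ n then g n else 0) (g W * ∑' n, g n) := by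
    intro W hW g hg hgm
    rw [← (mul_right_injective₀ hW).hasSum_iff]
    · simpa [Function.comp_def, hgm] using hg.hasSum.mul_left (g W)
    · intro n hn
      exact if_neg fun ⟨m, hm⟩ ↦ hn ⟨m, hm.symm⟩
  have hs1 : Summable fun i ↦ ‖-f (w i)‖ := by simpa using hs
  have hsum := summable_finsetProd_of_summable_norm hs1
  let K : Finset ι → GaussianInt → ℝ := fun T n ↦
    f n * if ∏ i ∈ T, w i ∣ n then (-1 : ℝ) ^ T.card else 0
  have hK : Summable (Function.uncurry K) := by
    refine Summable.of_norm ((summable_prod_of_nonneg fun _ ↦ norm_nonneg _).2 ?_)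
    have h1 : ∀ T : Finset ι, HasSum (fun n ↦ ‖Function.uncurry K (T, n)‖)
        (‖f (∏ i ∈ T, w i)‖ * ∑' n, ‖f n‖) := fun T ↦ by
      convert hmult _ (hW0 T) (fun n ↦ ‖f n‖) hf (fun a b ↦ by rw [hmul, norm_mul]) using 2 with n
      simp only [Function.uncurry, K]
      split_ifs <;> simp
    refine ⟨fun T ↦ (h1 T).summable, ?_⟩
    simp_rw [fun T ↦ (h1 T).tsum_eq, hprod, norm_prod]
    exact (summable_finsetProd_of_summable_nonneg (fun i ↦ norm_nonneg _) hs).mul_right _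
  have hcomm := hK.tsum_comm
  rw [tprod_one_add hsum, ← tsum_mul_left]
  convert hcomm.symm using 1
  · refine tsum_congr fun T ↦ ?_
    have := (hmult _ (hW0 T) f hf.of_norm hmul).mul_left ((-1) ^ T.card)
    rw [Finset.prod_neg, ← hprod, mul_left_comm, mul_comm (∑' n, f n), ← this.tsum_eq]
    refine tsum_congr fun n ↦ ?_
    simp only [K]
    split_ifs <;> ring
  · refine tsum_congr fun n ↦ ?_
    rcases eq_or_ne n 0 with rfl | hn
    · simp [K, hf0]
    · rw [((hasSum_inclusion_exclusion hw (hfin n hn)).mul_left (f n)).tsum_eq]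
      simp

end Sieve

section Norm

/-- The `ℤ`-linear coordinates `n ↦ (re n, im n)` on the Gaussian integers. -/
def coordEquiv : GaussianInt ≃ₗ[ℤ] (Fin 2 → ℤ) where
  toFun n := ![n.re, n.im]
  invFun v := ⟨v 0, v 1⟩
  map_add' a b := by ext i; fin_cases i <;> simp
  map_smul' c a := by ext i; fin_cases i <;> simp
  left_inv n := rfl
  right_inv v := by ext i; fin_cases i <;> rfl

lemma algebraNorm_eq (n : GaussianInt) : Algebra.norm ℤ n = Zsqrtd.norm n := by
  rw [Algebra.norm_eq_matrix_det (Module.Basis.ofEquivFun coordEquiv), Matrix.det_fin_two]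
  have h1 : ∀ n, coordEquiv n = ![n.re, n.im] := fun _ ↦ rfl
  have h2 : ∀ v, coordEquiv.symm v = ⟨v 0, v 1⟩ := fun _ ↦ rfl
  simp [Algebra.leftMulMatrix_eq_repr_mul, h1, h2, Zsqrtd.norm_def]

lemma card_quotient_span (n : GaussianInt) :
    Nat.card (GaussianInt ⧸ Ideal.span ({n} : Set GaussianInt)) = Gnorm n := by
  have := Module.Free.of_basis (Module.Basis.ofEquivFun coordEquiv)
  have := Module.Finite.of_basis (Module.Basis.ofEquivFun coordEquiv)
  rw [← Submodule.cardQuot_apply, ← Ideal.absNorm_apply, Ideal.absNorm_span_singleton,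
    algebraNorm_eq, Gnorm]

end Norm

section Primes

/-- The nonzero prime ideals of `ℤ[i]`. -/
abbrev PrimeIdx : Type := {P : Ideal GaussianInt // P.IsPrime ∧ P ≠ ⊥}

lemma span_genG (I : Ideal GaussianInt) : Ideal.span {genG I} = I :=
  Ideal.span_singleton_generator I

lemma genG_dvd_iff {I : Ideal GaussianInt} {n : GaussianInt} : genG I ∣ n ↔ n ∈ I :=
  (Submodule.IsPrincipal.mem_iff_generator_dvd I).symm

lemma prime_genG (P : PrimeIdx) : Prime (genG P.1) :=
  have := P.2.1
  Submodule.IsPrincipal.prime_generator_of_isPrime P.1 P.2.2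

lemma genG_injective : Function.Injective fun P : PrimeIdx ↦ genG P.1 := fun P Q h ↦ by
  rw [Subtype.ext_iff, ← span_genG P.1, ← span_genG Q.1]
  exact congrArg (fun x ↦ Ideal.span {x}) h

lemma eq_of_genG_dvd {P Q : PrimeIdx} (h : genG P.1 ∣ genG Q.1) : P = Q := by
  rw [Subtype.ext_iff, ← span_genG P.1, ← span_genG Q.1, Ideal.span_singleton_eq_span_singleton]
  exact (prime_genG P).associated_of_dvd (prime_genG Q) h

lemma pairwise_isRelPrime_genG :
    Pairwise (Function.onFun IsRelPrime fun P : PrimeIdx ↦ genG P.1) := fun _ _ hPQ ↦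
  (prime_genG _).irreducible.isRelPrime_iff_not_dvd.2 fun h ↦ hPQ (eq_of_genG_dvd h)

lemma exists_genG_associated {p : GaussianInt} (hp : Prime p) :
    ∃ P : PrimeIdx, Associated (genG P.1) p := by
  refine ⟨⟨Ideal.span {p}, (Ideal.span_singleton_prime hp.ne_zero).2 hp, ?_⟩, ?_⟩
  · simpa using hp.ne_zero
  · rw [← Ideal.span_singleton_eq_span_singleton, span_genG]

lemma summable_genG {s : ℝ} (hs : 1 < s) :
    Summable fun P : PrimeIdx ↦ (Gnorm (genG P.1) : ℝ) ^ (-s) :=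
  (summable_Gnorm_rpow hs).comp_injective genG_injective

lemma finite_genG_dvd {n : GaussianInt} (hn : n ≠ 0) : {P : PrimeIdx | genG P.1 ∣ n}.Finite :=
  finite_dvd_of_summable two_pos (fun P ↦ (prime_genG P).ne_zero) (summable_genG one_lt_two) hn

lemma forall_not_genG_dvd_iff {n : GaussianInt} (hn : n ≠ 0) :
    (∀ P : PrimeIdx, ¬ genG P.1 ∣ n) ↔ IsUnit n := by
  refine ⟨fun h ↦ ?_, fun h P hP ↦ (prime_genG P).not_isUnit (isUnit_of_dvd_unit hP h)⟩
  by_contra hu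
  obtain ⟨p, hp, hpn⟩ := WfDvdMonoid.exists_irreducible_factor hu hn
  obtain ⟨P, hP⟩ := exists_genG_associated hp.prime
  exact h P (hP.dvd.trans hpn)

lemma isUnit_iff_mem (n : GaussianInt) :
    IsUnit n ↔ n ∈ ({1, -1, ⟨0, 1⟩, ⟨0, -1⟩} : Finset GaussianInt) := by
  rw [← Zsqrtd.norm_eq_one_iff' (by norm_num), Zsqrtd.norm_def]
  constructor
  · intro h
    have h1 : n.re ^ 2 ≤ 1 := by nlinarith [mul_self_nonneg n.im]
    have h2 : n.im ^ 2 ≤ 1 := by nlinarith [mul_self_nonneg n.re]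
    obtain ⟨a, b⟩ := n
    simp only [sq_le_one_iff_abs_le_one, abs_le] at h h1 h2
    obtain ⟨h1, h1'⟩ := h1
    obtain ⟨h2, h2'⟩ := h2
    interval_cases a <;> interval_cases b <;> first | omega | decide
  · intro h
    simp only [Finset.mem_insert, Finset.mem_singleton] at h
    rcases h with rfl | rfl | rfl | rfl <;> decide

theorem zetaQi_mul_tprod :
    zetaQi * ∏' P : PrimeIdx, (1 + -((Gnorm (genG P.1) : ℝ) ^ 2)⁻¹) = 1 := by
  classical
  set f : GaussianInt → ℝ := fun n ↦ ((Gnorm n : ℝ) ^ 2)⁻¹ with hf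
  have hfr : ∀ n, ‖f n‖ = (Gnorm n : ℝ) ^ (-2 : ℝ) := fun n ↦ by
    rw [Real.norm_of_nonneg (by positivity), Real.rpow_neg (by positivity)]
    norm_num [hf]
  have hsum : Summable fun n ↦ ‖f n‖ := by
    simpa only [hfr] using summable_Gnorm_rpow one_lt_two
  have hf0 : f 0 = 0 := by simp [hf, Gnorm]
  have hz : zetaQi = 1 / 4 * ∑' n, f n := by
    have hsupp : Function.support f ⊆ {n | n ≠ 0} := fun n hn h0 ↦ hn (h0 ▸ hf0)
    rw [zetaQi, ← tsum_subtype_eq_of_support_subset hsupp]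
    simp only [hf, one_div]
    rfl
  have h := tsum_mul_tprod_eq_tsum_coprime (w := fun P : PrimeIdx ↦ genG P.1) hsum hf0
    (fun a b ↦ by simp [hf, Gnorm_mul, mul_pow, mul_comm]) pairwise_isRelPrime_genG
    (fun P ↦ (prime_genG P).ne_zero) (fun _ ↦ finite_genG_dvd)
    (hsum.comp_injective genG_injective) (by simp [hf, Gnorm])
  have hunits : (∑' n, if ∀ P : PrimeIdx, ¬ genG P.1 ∣ n then f n else 0) = 4 := by
    rw [tsum_eq_sum (s := {1, -1, ⟨0, 1⟩, ⟨0, -1⟩})]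
    · rw [Finset.sum_congr rfl (g := fun _ ↦ (1 : ℝ))]
      · rw [Finset.sum_const]
        norm_num [show ({1, -1, ⟨0, 1⟩, ⟨0, -1⟩} : Finset GaussianInt).card = 4 by decide]
      · intro n hn
        have hu := (isUnit_iff_mem n).2 hn
        rw [if_pos ((forall_not_genG_dvd_iff hu.ne_zero).2 hu)]
        have h1 : Gnorm n = 1 := Zsqrtd.norm_eq_one_iff.2 hu
        simp [hf, h1]
    · intro n hn
      rcases eq_or_ne n 0 with rfl | h0
      · simp [hf0]
      · rw [← isUnit_iff_mem, ← forall_not_genG_dvd_iff h0] at hn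
        exact if_neg hn
  rw [hz, mul_assoc, h, hunits]
  norm_num

lemma two_pow_le_tauI {q : GaussianInt} (hq : q ≠ 0) :
    2 ^ (finite_genG_dvd hq).toFinset.card ≤ tauI q := by
  classical
  have hne : Ideal.span ({q} : Set GaussianInt) ≠ 0 := by simpa using hq
  have : Finite {I : Ideal GaussianInt // I ∣ Ideal.span ({q} : Set GaussianInt)} :=
    (UniqueFactorizationMonoid.fintypeSubtypeDvd _ hne).finite
  have hmem : ∀ P : PrimeIdx, P ∈ (finite_genG_dvd hq).toFinset ↔ genG P.1 ∣ q := by simp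
  have hdvd : ∀ T : Finset PrimeIdx, ∀ P, genG P.1 ∣ ∏ Q ∈ T, genG Q.1 ↔ P ∈ T := fun T P ↦ by
    rw [(prime_genG P).dvd_finsetProd_iff]
    exact ⟨fun ⟨Q, hQ, h⟩ ↦ eq_of_genG_dvd h ▸ hQ, fun h ↦ ⟨P, h, dvd_rfl⟩⟩
  let F : (finite_genG_dvd hq).toFinset.powerset →
      {I : Ideal GaussianInt // I ∣ Ideal.span ({q} : Set GaussianInt)} := fun T ↦
    ⟨Ideal.span {∏ P ∈ T.1, genG P.1}, by
      rw [Ideal.span_singleton_dvd_span_singleton_iff_dvd, prod_dvd_iff pairwise_isRelPrime_genG]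
      exact fun P hP ↦ (hmem P).1 (Finset.mem_powerset.1 T.2 hP)⟩
  have hF : Function.Injective F := fun T T' h ↦ by
    have h' := Ideal.span_singleton_eq_span_singleton.1 (congrArg Subtype.val h)
    ext P
    rw [← hdvd, ← hdvd, h'.dvd_iff_dvd_right]
  rw [← Finset.card_powerset, tauI, ← Nat.card_eq_finsetCard]
  exact Nat.card_le_card_of_injective F hF

end Primes

section Weights

open Classical in
/-- The sieving modulus at `P`: `s` is squarefree and coprime to `q` iff no modulus divides it. -/
def sieveMod (q : GaussianInt) (P : PrimeIdx) : GaussianInt :=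
  if genG P.1 ∣ q then genG P.1 else genG P.1 ^ 2

variable {q : GaussianInt}

lemma sieveMod_ne_zero (P : PrimeIdx) : sieveMod q P ≠ 0 := by
  rw [sieveMod]
  split_ifs
  · exact (prime_genG P).ne_zero
  · exact pow_ne_zero 2 (prime_genG P).ne_zero

lemma pairwise_isRelPrime_sieveMod : Pairwise (Function.onFun IsRelPrime (sieveMod q)) := by
  intro P Q h
  have := pairwise_isRelPrime_genG h
  simp only [Function.onFun, sieveMod] at this ⊢
  split_ifs
  · exact this
  · exact this.pow_right
  · exact this.pow_left
  · exact this.pow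

lemma forall_not_sieveMod_dvd_iff {s : GaussianInt} (hs : s ≠ 0) :
    (∀ P, ¬ sieveMod q P ∣ s) ↔ Squarefree s ∧ IsUnit (EuclideanDomain.gcd s q) := by
  have hle : ∀ P, sieveMod q P ∣ genG P.1 ^ 2 := fun P ↦ by
    rw [sieveMod]
    split_ifs
    · exact dvd_pow_self _ two_ne_zero
    · rfl
  constructor
  · intro h
    constructor
    · rw [squarefree_iff_irreducible_sq_not_dvd_of_ne_zero hs]
      intro p hp hps
      obtain ⟨P, hP⟩ := exists_genG_associated hp.prime
      refine h P ((hle P).trans (((pow_dvd_pow_of_dvd hP.dvd 2)).trans ?_))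
      rwa [sq]
    · have hg : EuclideanDomain.gcd s q ≠ 0 := fun h0 ↦
        hs (EuclideanDomain.gcd_eq_zero_iff.1 h0).1
      rw [← forall_not_genG_dvd_iff hg]
      intro P hP
      refine h P ?_
      rw [sieveMod, if_pos (hP.trans (EuclideanDomain.gcd_dvd_right _ _))]
      exact hP.trans (EuclideanDomain.gcd_dvd_left _ _)
  · rintro ⟨hsq, hu⟩ P hP
    rw [sieveMod] at hP
    split_ifs at hP with h
    · exact (prime_genG P).not_isUnit (isUnit_of_dvd_unit (EuclideanDomain.dvd_gcd hP h) hu)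
    · exact (prime_genG P).not_isUnit (hsq _ (by rwa [← sq]))

lemma summable_sieveMod (hq : q ≠ 0) {θ : ℝ} (hθ : 1 / 2 < θ) :
    Summable fun P ↦ (Gnorm (sieveMod q P) : ℝ) ^ (-θ) := by
  refine (summable_genG (s := 2 * θ) (by linarith)).congr_cofinite ?_
  refine (finite_genG_dvd hq).subset fun P hP ↦ ?_
  by_contra h
  refine hP ?_
  have h' : sieveMod q P = genG P.1 ^ 2 := if_neg h
  change (Gnorm (genG P.1) : ℝ) ^ (-(2 * θ)) = (Gnorm (sieveMod q P) : ℝ) ^ (-θ)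
  rw [h', sq, Gnorm_mul]
  push_cast
  rw [← sq, ← Real.rpow_natCast_mul (by positivity)]
  congr 1
  push_cast
  ring

lemma tprod_sieveMod_le (hq : q ≠ 0) {θ : ℝ} (hθ : 1 / 2 < θ) :
    ∏' P, (1 + (Gnorm (sieveMod q P) : ℝ) ^ (-θ)) ≤
      2 ^ (finite_genG_dvd hq).toFinset.card *
        ∏' P : PrimeIdx, (1 + (Gnorm (genG P.1) : ℝ) ^ (-(2 * θ))) := by
  classical
  have hm1 := (Real.multipliable_one_add_of_summable (summable_sieveMod hq hθ)).hasProd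
  have hm2 := (Real.multipliable_one_add_of_summable
    (summable_genG (s := 2 * θ) (by linarith))).hasProd
  have hm3 : HasProd (fun P : PrimeIdx ↦ if genG P.1 ∣ q then (2 : ℝ) else 1)
      (2 ^ (finite_genG_dvd hq).toFinset.card) := by
    have := hasProd_prod_of_ne_finset_one (L := .unconditional _)
      (s := (finite_genG_dvd hq).toFinset)
      (f := fun P : PrimeIdx ↦ if genG P.1 ∣ q then (2 : ℝ) else 1)
      fun P hP ↦ if_neg (by simpa using hP)
    rwa [Finset.prod_congr rfl (g := fun _ ↦ (2 : ℝ)) fun P hP ↦ if_pos (by simpa using hP),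
      Finset.prod_const] at this
  refine le_of_tendsto_of_tendsto' hm1 (hm3.mul hm2) fun T ↦
    Finset.prod_le_prod (fun P _ ↦ by positivity) fun P _ ↦ ?_
  have hN : (1 : ℝ) ≤ Gnorm (genG P.1) := by
    exact_mod_cast Gnorm_pos.2 (prime_genG P).ne_zero
  rw [sieveMod]
  split_ifs
  · have h1 : (Gnorm (genG P.1) : ℝ) ^ (-θ) ≤ 1 :=
      Real.rpow_le_one_of_one_le_of_nonpos hN (by linarith)
    have h2 : 0 ≤ (Gnorm (genG P.1) : ℝ) ^ (-(2 * θ)) := by positivity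
    linarith
  · rw [one_mul, sq, Gnorm_mul]
    push_cast
    rw [← sq, ← Real.rpow_natCast_mul (by positivity)]
    refine le_of_eq ?_
    congr 2
    push_cast
    ring

lemma tprod_sieveMod_eq (hq : q ≠ 0) :
    ∏' P, (1 + -(Gnorm (sieveMod q P) : ℝ)⁻¹) = 1 / zetaQi *
      ∏ᶠ P ∈ {P : Ideal GaussianInt | P.IsPrime ∧ Ideal.span ({q} : Set GaussianInt) ≤ P},
        (1 + (Nat.card (GaussianInt ⧸ P) : ℝ)⁻¹)⁻¹ := by
  classical
  set r : PrimeIdx → ℝ := fun P ↦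
    if genG P.1 ∣ q then (1 + (Gnorm (genG P.1) : ℝ)⁻¹)⁻¹ else 1 with hr
  have hfin := finite_genG_dvd hq
  have hr1 : ∀ P ∉ hfin.toFinset, r P = 1 := fun P hP ↦ if_neg (by simpa using hP)
  have hprod : ∏' P, r P =
      ∏ᶠ P ∈ {P : Ideal GaussianInt | P.IsPrime ∧ Ideal.span ({q} : Set GaussianInt) ≤ P},
        (1 + (Nat.card (GaussianInt ⧸ P) : ℝ)⁻¹)⁻¹ := by
    rw [tprod_eq_prod hr1, ← finprod_mem_eq_finite_toFinset_prod _ hfin]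
    refine finprod_mem_eq_of_bijOn Subtype.val ⟨fun P hP ↦ ⟨P.2.1, ?_⟩,
      Subtype.val_injective.injOn, fun P hP ↦ ?_⟩ fun P hP ↦ ?_
    · rw [Ideal.span_singleton_le_iff_mem]
      exact genG_dvd_iff.1 hP
    · obtain ⟨h1, h2⟩ := hP
      refine ⟨⟨P, h1, ?_⟩, ?_, rfl⟩
      · rintro rfl
        simp [hq] at h2
      · rw [Ideal.span_singleton_le_iff_mem] at h2
        exact genG_dvd_iff.2 h2
    · rw [← span_genG P.1, card_quotient_span]
      exact if_pos hP
  have hz := zetaQi_mul_tprod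
  have hm1 : Multipliable fun P : PrimeIdx ↦ 1 + -((Gnorm (genG P.1) : ℝ) ^ 2)⁻¹ := by
    refine Real.multipliable_one_add_of_summable (Summable.neg ?_)
    refine (summable_genG one_lt_two).congr fun P ↦ ?_
    rw [Real.rpow_neg (by positivity)]
    norm_num
  have hm2 : Multipliable r :=
    (hasProd_prod_of_ne_finset_one (L := .unconditional _) hr1).multipliable
  rw [← hprod, ← eq_one_div_of_mul_eq_one_right hz, ← hm1.tprod_mul hm2]
  refine tprod_congr fun P ↦ ?_
  have hN : (0 : ℝ) < Gnorm (genG P.1) := by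
    exact_mod_cast Gnorm_pos.2 (prime_genG P).ne_zero
  rw [hr, sieveMod]
  dsimp only
  split_ifs
  · field_simp
    ring
  · rw [sq, Gnorm_mul, mul_one]
    push_cast
    rw [sq]

end Weights

theorem stmt3 : ∀ ε : ℝ, 0 < ε → ∃ C : ℝ, 0 < C ∧
    ∀ S : ℝ, 1 ≤ S → ∀ q : GaussianInt, q ≠ 0 →
    |(Nat.card {s : GaussianInt // 0 < Gnorm s ∧ (Gnorm s : ℝ) ≤ S ∧ Squarefree s ∧
          IsUnit (EuclideanDomain.gcd s q)} : ℝ) -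
        Real.pi * S / zetaQi *
          ∏ᶠ P ∈ {P : Ideal GaussianInt | P.IsPrime ∧ Ideal.span ({q} : Set GaussianInt) ≤ P},
            (1 + (Nat.card (GaussianInt ⧸ P) : ℝ)⁻¹)⁻¹| ≤
      C * (tauI q : ℝ) * S ^ ((1 : ℝ) / 2 + ε) := by
  classical
  intro ε hε
  set θ := min (1 / 2 + ε) 1
  have hθ : 1 / 2 < θ := lt_min (by linarith) (by norm_num)
  have hθ' : θ ≤ 1 := min_le_right _ _
  set B := ∏' P : PrimeIdx, (1 + (Gnorm (genG P.1) : ℝ) ^ (-(2 * θ)))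
  have hpi := Real.pi_pos
  refine ⟨(8 * Real.pi + 1) * (|B| + 1), by positivity, fun S hS q hq ↦ ?_⟩
  have hcard : Nat.card {s : GaussianInt // 0 < Gnorm s ∧ (Gnorm s : ℝ) ≤ S ∧ Squarefree s ∧
      IsUnit (EuclideanDomain.gcd s q)} =
      ((normBall S).filter fun s ↦ ∀ P, ¬ sieveMod q P ∣ s).card := by
    refine Nat.subtype_card _ fun s ↦ ?_
    rw [Finset.mem_filter, mem_normBall, Gnorm_pos, and_assoc]
    refine and_congr_right fun hs ↦ and_congr_right fun _ ↦ forall_not_sieveMod_dvd_iff hs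
  have h := abs_card_sieve_sub_le hθ.le hθ' pairwise_isRelPrime_sieveMod sieveMod_ne_zero
    (summable_sieveMod hq hθ) (by linarith : 0 < S)
  rw [tprod_sieveMod_eq hq] at h
  rw [hcard, div_eq_mul_one_div, mul_assoc (Real.pi * S)]
  refine h.trans ?_
  have h1 : S ^ θ ≤ S ^ ((1 : ℝ) / 2 + ε) :=
    Real.rpow_le_rpow_of_exponent_le hS (min_le_left _ _)
  have h2 : ∏' P, (1 + (Gnorm (sieveMod q P) : ℝ) ^ (-θ)) ≤ tauI q * (|B| + 1) := by
    refine (tprod_sieveMod_le hq hθ).trans ?_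
    have h3 : (2 : ℝ) ^ (finite_genG_dvd hq).toFinset.card ≤ tauI q := by
      exact_mod_cast two_pow_le_tauI hq
    have h4 := le_abs_self B
    exact mul_le_mul h3 (by linarith) (tprod_nonneg fun _ ↦ by positivity) (by positivity)
  calc (8 * Real.pi + 1) * S ^ θ * ∏' P, (1 + (Gnorm (sieveMod q P) : ℝ) ^ (-θ))
      ≤ (8 * Real.pi + 1) * S ^ θ * (tauI q * (|B| + 1)) := by gcongr
    _ ≤ (8 * Real.pi + 1) * S ^ ((1 : ℝ) / 2 + ε) * (tauI q * (|B| + 1)) := by gcongr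
    _ = _ := by ring

end PGT
end
end

section
/- For every nonzero c ∈ ℤ[i] and every a ∈ ℤ[i], ρ(c, a) = ρ_c(a² − 4); that is, the number of residue classes d modulo c with d² − a·d + 1 ≡ 0 (mod c) equals the number of residue classes x modulo 2c with x² ≡ a² − 4 (mod 4c). -/
noncomputable section

namespace PGT

theorem two_dvd_sub_of_four_dvd_sq_sub_sq {y a : GaussianInt} (h : 4 ∣ y ^ 2 - a ^ 2) :
    2 ∣ y - a := by
  obtain ⟨k, hk⟩ := h
  have h2 : algebraMap GaussianInt (FractionRing GaussianInt) 2 ≠ 0 := by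
    rw [Ne, FaithfulSMul.algebraMap_eq_zero_iff]
    decide
  let f := algebraMap GaussianInt (FractionRing GaussianInt)
  have hint : IsIntegral GaussianInt (f (y - a) / f 2) := by
    refine ⟨Polynomial.X ^ 2 + Polynomial.C a * Polynomial.X - Polynomial.C k, by monicity!, ?_⟩
    have hk' : f y ^ 2 - f a ^ 2 = f 2 ^ 2 * f k := by
      rw [← map_pow, ← map_pow, ← map_sub, ← map_pow, ← map_mul, hk]
      norm_num
    have h2' : f 2 = 2 := map_ofNat f 2
    have h20 : (2 : FractionRing GaussianInt) ≠ 0 := h2' ▸ h2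
    simp only [Polynomial.eval₂_sub, Polynomial.eval₂_add, Polynomial.eval₂_mul,
      Polynomial.eval₂_pow, Polynomial.eval₂_X, Polynomial.eval₂_C]
    change (f (y - a) / f 2) ^ 2 + f a * (f (y - a) / f 2) - f k = 0
    rw [map_sub, h2']
    rw [h2'] at hk'
    field_simp
    linear_combination hk'
  obtain ⟨w, hw⟩ := IsIntegrallyClosed.isIntegral_iff.mp hint
  refine ⟨w, FaithfulSMul.algebraMap_injective GaussianInt (FractionRing GaussianInt) ?_⟩
  rw [map_mul, hw, mul_div_cancel₀ _ h2]

theorem mk_quadratic_eq_zero_iff (c a d : GaussianInt) :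
    Ideal.Quotient.mk (Ideal.span ({c} : Set GaussianInt)) d ^ 2 -
        Ideal.Quotient.mk (Ideal.span ({c} : Set GaussianInt)) a *
          Ideal.Quotient.mk (Ideal.span ({c} : Set GaussianInt)) d + 1 = 0 ↔
      4 * c ∣ (2 * d - a) ^ 2 - (a ^ 2 - 4) := by
  rw [← map_pow, ← map_mul, ← map_sub, ← map_one (Ideal.Quotient.mk _), ← map_add,
    Ideal.Quotient.eq_zero_iff_dvd,
    show (2 * d - a) ^ 2 - (a ^ 2 - 4) = 4 * (d ^ 2 - a * d + 1) by ring]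
  exact (mul_dvd_mul_iff_left (by decide)).symm

theorem mk_two_mul_sub_eq_iff (c a d e : GaussianInt) :
    Ideal.Quotient.mk (Ideal.span ({2 * c} : Set GaussianInt)) (2 * d - a) =
        Ideal.Quotient.mk (Ideal.span ({2 * c} : Set GaussianInt)) (2 * e - a) ↔
      Ideal.Quotient.mk (Ideal.span ({c} : Set GaussianInt)) d =
        Ideal.Quotient.mk (Ideal.span ({c} : Set GaussianInt)) e := by
  rw [Ideal.Quotient.eq, Ideal.Quotient.eq, Ideal.mem_span_singleton, Ideal.mem_span_singleton,
    show 2 * d - a - (2 * e - a) = 2 * (d - e) by ring]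
  exact mul_dvd_mul_iff_left (by decide)

theorem stmt4 : ∀ c : GaussianInt, c ≠ 0 → ∀ a : GaussianInt,
    rhoG c a = rhoc c (a ^ 2 - 4) := by
  intro c _ a
  refine Nat.card_congr (Equiv.ofBijective (fun d => ⟨Ideal.Quotient.mk _
    (2 * Quotient.out d.1 - a), _, rfl, (mk_quadratic_eq_zero_iff c a _).mp ?_⟩) ⟨?_, ?_⟩)
  · rw [Ideal.Quotient.mk_out]
    exact d.2
  · intro d e hde
    have h := (mk_two_mul_sub_eq_iff c a _ _).mp (congrArg Subtype.val hde)
    rw [Ideal.Quotient.mk_out, Ideal.Quotient.mk_out] at h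
    exact Subtype.ext h
  · rintro ⟨_, y, rfl, hy⟩
    obtain ⟨w, hw⟩ : 2 ∣ y - a := by
      refine two_dvd_sub_of_four_dvd_sq_sub_sq ?_
      have h := dvd_sub (dvd_of_mul_right_dvd hy) (dvd_refl 4)
      rwa [show y ^ 2 - (a ^ 2 - 4) - 4 = y ^ 2 - a ^ 2 by ring] at h
    obtain rfl : y = 2 * (w + a) - a := by linear_combination hw
    refine ⟨⟨Ideal.Quotient.mk _ (w + a), (mk_quadratic_eq_zero_iff c a _).mpr hy⟩, ?_⟩
    exact Subtype.ext ((mk_two_mul_sub_eq_iff c a _ _).mpr (Ideal.Quotient.mk_out _))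

end PGT
end
end
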